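/- arXiv:2302.03588 — 2 statements merged into one kernel-verified Lean document; each statement's English description precedes it below -/
import Mathlib

section
/- Let f : X → (−∞,∞] be a convex function and let x ∈ dom f. If f is continuous at x, then ∂f(x) ≠ ∅. -/
/-!
Basic convex analysis in metric spaces with bounded curvature:
common definitions (geodesics, Alexandrov angles, tangent-space elements,
normal cones, subdifferentials, CAT(κ) conditions).
-/

open Metric Real Set Filter

noncomputable section

namespace CATPaper

/-- A geodesic of length `l` in a metric space `X`: a map `ℝ → X` that is isometric
on `[0, l]` (values outside `[0, l]` are irrelevant). -/
structure Geodesic (X : Type*) [MetricSpace X] where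
  l : ℝ
  l_nonneg : 0 ≤ l
  map : ℝ → X
  isom : ∀ s ∈ Set.Icc (0:ℝ) l, ∀ t ∈ Set.Icc (0:ℝ) l, dist (map s) (map t) = |s - t|

variable {X : Type*} [MetricSpace X]

/-- The constant geodesic at a point. -/
def constGeod (x : X) : Geodesic X :=
  ⟨0, le_rfl, fun _ => x, by
    rintro s ⟨hs0, hs1⟩ t ⟨ht0, ht1⟩
    have : s = t := by nlinarith
    simp [this]⟩

/-- `γ` is a geodesic from `x` to `y` (parametrized by arclength on `[0, d(x,y)]`). -/
def GeodesicFromTo (γ : Geodesic X) (x y : X) : Prop :=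
  γ.map 0 = x ∧ γ.l = dist x y ∧ γ.map γ.l = y

/-- Every two points of `X` are joined by a geodesic. -/
def GeodesicSpace (X : Type*) [MetricSpace X] : Prop :=
  ∀ x y : X, ∃ γ : Geodesic X, GeodesicFromTo γ x y

/-- Every two points of `X` are joined by a unique geodesic segment. -/
def UniquelyGeodesic (X : Type*) [MetricSpace X] : Prop :=
  ∀ (x y : X) (γ η : Geodesic X), GeodesicFromTo γ x y → GeodesicFromTo η x y →
    ∀ t ∈ Set.Icc (0:ℝ) (dist x y), γ.map t = η.map t

/-- The geodesic extension property around `x` with constant `R`: any geodesic between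
distinct points `y, z ∈ B(x,R)` with `d(y,z) < R` extends beyond `z` to a geodesic of
length `R`. -/
def GeodExtAround (x : X) (R : ℝ) : Prop :=
  ∀ y z : X, y ∈ Metric.ball x R → z ∈ Metric.ball x R → y ≠ z → dist y z < R →
    ∃ γ : Geodesic X, γ.l = R ∧ γ.map 0 = y ∧ γ.map (dist y z) = z

/-- The (global) geodesic extension property: every nondegenerate geodesic segment is
contained in a geodesic line. -/
def GeodExtGlobal (X : Type*) [MetricSpace X] : Prop :=
  ∀ γ : Geodesic X, 0 < γ.l → ∃ g : ℝ → X,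
    (∀ s t : ℝ, dist (g s) (g t) = |s - t|) ∧ ∀ t ∈ Set.Icc (0:ℝ) γ.l, g t = γ.map t

/-- The Euclidean comparison angle at the vertex `x` of the triple `(p, x, q)`. -/
def compAngle (x p q : X) : ℝ :=
  Real.arccos ((dist x p ^ 2 + dist x q ^ 2 - dist p q ^ 2) / (2 * dist x p * dist x q))

/-- The Alexandrov angle between two geodesics issuing at the same point: the limit as
`s, t ↘ 0` of the Euclidean comparison angles (junk value if the limit does not exist). -/
def alexAngle (γ η : Geodesic X) : ℝ :=
  limUnder ((nhdsWithin (0:ℝ) (Set.Ioi 0)) ×ˢ (nhdsWithin (0:ℝ) (Set.Ioi 0)))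
    (fun p : ℝ × ℝ => compAngle (γ.map 0) (γ.map p.1) (η.map p.2))

/-- `([γ], r)` is an element of the tangent space at `x`: `γ` issues at `x`, `r ≥ 0`, and
`γ` is nonconstant unless `r = 0` (in which case `([γ], r)` is the origin `o_x`). -/
def InTangent (x : X) (γ : Geodesic X) (r : ℝ) : Prop :=
  γ.map 0 = x ∧ 0 ≤ r ∧ (r = 0 ∨ 0 < γ.l)

/-- Equality of directions `[γ] = [η]` (equivalence classes under zero Alexandrov angle;
constant geodesics all represent the degenerate direction). -/
def DirEq (γ η : Geodesic X) : Prop :=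
  (γ.l = 0 ∧ η.l = 0) ∨ (0 < γ.l ∧ 0 < η.l ∧ alexAngle γ η = 0)

/-- The scalar product `⟨([γ], r), ([η], s)⟩ = r·s·cos ∠(γ, η)` of two tangent-space
elements. -/
def tInner (γ : Geodesic X) (r : ℝ) (η : Geodesic X) (s : ℝ) : ℝ :=
  r * s * Real.cos (alexAngle γ η)

/-- The tangent-space elements `([γ], r)` and `([η], s)` are opposite to each other. -/
def TanOpposite (γ : Geodesic X) (r : ℝ) (η : Geodesic X) (s : ℝ) : Prop :=
  (r = 0 ∧ s = 0) ∨ (r = s ∧ 0 < r ∧ alexAngle γ η = π)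

/-- The metric projection of `z` onto `C`: the set of points of `C` nearest to `z`. -/
def projSet (C : Set X) (z : X) : Set X :=
  {y ∈ C | ∀ c ∈ C, dist z y ≤ dist z c}

/-- A set is convex if it contains every geodesic segment between its points. -/
def GConvex (C : Set X) : Prop :=
  ∀ γ : Geodesic X, γ.map 0 ∈ C → γ.map γ.l ∈ C → ∀ t ∈ Set.Icc (0:ℝ) γ.l, γ.map t ∈ C

/-- `([γ], r)` belongs to the normal cone of `C` at `x`: `r = 0`, or `x` is the metric
projection onto `C` of `γ(t)` for some `t > 0`. -/
def InNormalCone (C : Set X) (x : X) (γ : Geodesic X) (r : ℝ) : Prop :=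
  r = 0 ∨ ∃ t : ℝ, 0 < t ∧ t ≤ γ.l ∧ projSet C (γ.map t) = {x}

/-- The diameter `D_κ = π/√κ` of the model space `M_κ²` for `κ > 0`. -/
def Dk (κ : ℝ) : ℝ := π / Real.sqrt κ

/-- The comparison distance in the model sphere `M_κ²` of curvature `κ > 0`: the distance
from the vertex `p̄` to the point at arclength `t` along the side `q̄ r̄` of a comparison
triangle with `d(q,r) = a`, `d(p,q) = b`, `d(p,r) = c`, computed via the spherical law of
cosines. -/
def modelCompDist (κ a b c t : ℝ) : ℝ :=
  (1 / Real.sqrt κ) * Real.arccos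
    (Real.cos (Real.sqrt κ * b) * Real.cos (Real.sqrt κ * t) +
      Real.sin (Real.sqrt κ * b) * Real.sin (Real.sqrt κ * t) *
        ((Real.cos (Real.sqrt κ * c) - Real.cos (Real.sqrt κ * a) * Real.cos (Real.sqrt κ * b)) /
          (Real.sin (Real.sqrt κ * a) * Real.sin (Real.sqrt κ * b))))

/-- `X` is a `CAT(κ)` space for `κ > 0`: every two points at distance `< D_κ` are joined
by a geodesic, and every geodesic triangle of perimeter `< 2 D_κ` is no thicker than its
comparison triangle in the model sphere `M_κ²`. -/
def IsCATK (κ : ℝ) (X : Type*) [MetricSpace X] : Prop :=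
  (∀ x y : X, dist x y < Dk κ → ∃ γ : Geodesic X, GeodesicFromTo γ x y) ∧
  (∀ (p : X) (σ : Geodesic X),
    dist p (σ.map 0) + dist p (σ.map σ.l) + σ.l < 2 * Dk κ →
    ∀ t ∈ Set.Icc (0:ℝ) σ.l,
      dist p (σ.map t) ≤ modelCompDist κ σ.l (dist p (σ.map 0)) (dist p (σ.map σ.l)) t)

/-- `X` is a `CAT(0)` space: a geodesic space satisfying the `CAT(0)` comparison
inequality `d(z, γ(t·l))² ≤ (1-t)·d(z,γ(0))² + t·d(z,γ(l))² - t(1-t)·l²`. -/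
def IsCAT0 (X : Type*) [MetricSpace X] : Prop :=
  GeodesicSpace X ∧
  ∀ (z : X) (γ : Geodesic X), ∀ t ∈ Set.Icc (0:ℝ) 1,
    dist z (γ.map (t * γ.l)) ^ 2 ≤
      (1 - t) * dist z (γ.map 0) ^ 2 + t * dist z (γ.map γ.l) ^ 2 - t * (1 - t) * γ.l ^ 2

/-- The standing assumptions of the paper: `(X,d)` is a locally compact, uniquely geodesic
`CAT(κ)` space (`κ > 0`) having, around every point `x`, the geodesic extension property
with a constant `R x < D_κ/2`. -/
structure Standing (κ : ℝ) (X : Type*) [MetricSpace X] (R : X → ℝ) : Prop where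
  kpos : 0 < κ
  locComp : LocallyCompactSpace X
  cat : IsCATK κ X
  geod : GeodesicSpace X
  unique : UniquelyGeodesic X
  Rpos : ∀ x : X, 0 < R x
  Rsmall : ∀ x : X, R x < Dk κ / 2
  ext : ∀ x : X, GeodExtAround x (R x)

/-- A function `f : X → (-∞, ∞]` is convex if
`f(γ(t·l)) ≤ (1-t)·f(γ(0)) + t·f(γ(l))` along every geodesic. -/
def GConvexFn (f : X → EReal) : Prop :=
  ∀ (γ : Geodesic X), ∀ t ∈ Set.Icc (0:ℝ) 1,
    f (γ.map (t * γ.l)) ≤ ((1 - t : ℝ) : EReal) * f (γ.map 0) + (t : EReal) * f (γ.map γ.l)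

/-- The product `X × ℝ` equipped with the metric
`d₂((x₁,λ₁),(x₂,λ₂)) = √(d(x₁,x₂)² + |λ₁-λ₂|²)`. -/
abbrev XR (X : Type*) [MetricSpace X] : Type _ := WithLp 2 (X × ℝ)

/-- The point `(x, a)` of `X × ℝ`. -/
def toXR (x : X) (a : ℝ) : XR X := (WithLp.equiv 2 (X × ℝ)).symm (x, a)

/-- The epigraph of `f : X → (-∞, ∞]`, as a subset of `X × ℝ`. -/
def epigraph (f : X → EReal) : Set (XR X) :=
  {p : XR X | f ((WithLp.equiv 2 (X × ℝ)) p).1 ≤ ((((WithLp.equiv 2 (X × ℝ)) p).2 : ℝ) : EReal)}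

/-- `([γ], r) ∈ ∂f(x)`: the geodesic `σ(t) = (γ(rt/√(r²+1)), f(x) - t/√(r²+1))`,
`t ∈ [0, R₀]`, in `X × ℝ` satisfies `([σ], 1) ∈ N_{epi f}(x, f(x))`. -/
def IsSubgrad (R₀ : ℝ) (f : X → EReal) (x : X) (γ : Geodesic X) (r : ℝ) : Prop :=
  ∃ σ : Geodesic (XR X), σ.l = R₀ ∧
    (∀ t : ℝ, σ.map t =
      toXR (γ.map (r * t / Real.sqrt (r ^ 2 + 1)))
        ((f x).toReal - t / Real.sqrt (r ^ 2 + 1))) ∧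
    InNormalCone (epigraph f) (toXR x (f x).toReal) σ 1

/-- `([γ], r) ∈ ∂f(x)` in the `CAT(0)` setting, where the defining geodesic `σ` may be
taken on any interval `[0, l]`, `l > 0`. -/
def IsSubgrad0 (f : X → EReal) (x : X) (γ : Geodesic X) (r : ℝ) : Prop :=
  ∃ σ : Geodesic (XR X), 0 < σ.l ∧
    (∀ t : ℝ, σ.map t =
      toXR (γ.map (r * t / Real.sqrt (r ^ 2 + 1)))
        ((f x).toReal - t / Real.sqrt (r ^ 2 + 1))) ∧
    InNormalCone (epigraph f) (toXR x (f x).toReal) σ 1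

end CATPaper

namespace CATPaper

/-- The spherical form of Stewart's inequality in a `CAT(κ)` space. -/
lemma IsCATK.stewart {X : Type*} [MetricSpace X] {κ : ℝ} (hκ : 0 < κ) (h : IsCATK κ X)
    (q : X) (σ : Geodesic X) (hl : 0 < σ.l)
    (hper : dist q (σ.map 0) + dist q (σ.map σ.l) + σ.l < 2 * Dk κ)
    {t : ℝ} (ht : t ∈ Set.Icc (0 : ℝ) σ.l) :
    sin (√κ * (σ.l - t)) * cos (√κ * dist q (σ.map 0)) +
        sin (√κ * t) * cos (√κ * dist q (σ.map σ.l)) ≤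
      sin (√κ * σ.l) * cos (√κ * dist q (σ.map t)) := by
  have hk : 0 < √κ := Real.sqrt_pos.2 hκ
  have hcomp := h.2 q σ hper t ht
  have hlen : dist (σ.map 0) (σ.map σ.l) = σ.l := by
    rw [σ.isom 0 ⟨le_rfl, σ.l_nonneg⟩ σ.l ⟨σ.l_nonneg, le_rfl⟩, zero_sub, abs_neg,
      abs_of_nonneg σ.l_nonneg]
  have htri₁ : σ.l ≤ dist q (σ.map 0) + dist q (σ.map σ.l) := by
    have := dist_triangle_left (σ.map 0) (σ.map σ.l) q; linarith
  have htri₂ : dist q (σ.map 0) ≤ dist q (σ.map σ.l) + σ.l := by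
    have := dist_triangle q (σ.map σ.l) (σ.map 0)
    rw [dist_comm (σ.map σ.l)] at this; linarith
  have htri₃ : dist q (σ.map σ.l) ≤ dist q (σ.map 0) + σ.l := by
    have := dist_triangle q (σ.map 0) (σ.map σ.l); linarith
  have hb0 : 0 ≤ dist q (σ.map 0) := dist_nonneg
  have hc0 : 0 ≤ dist q (σ.map σ.l) := dist_nonneg
  have hd0 : 0 ≤ dist q (σ.map t) := dist_nonneg
  unfold modelCompDist at hcomp
  generalize dist q (σ.map 0) = b at *
  generalize dist q (σ.map σ.l) = c at *
  generalize dist q (σ.map t) = d at *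
  generalize σ.l = a at *
  obtain ⟨ht0, hta⟩ := ht
  have hDk : √κ * Dk κ = π := by unfold Dk; field_simp
  have ha : √κ * a < π := by rw [← hDk]; gcongr; linarith
  have hb : √κ * b < π := by rw [← hDk]; gcongr; linarith
  have hc : √κ * c < π := by rw [← hDk]; gcongr; linarith
  have hsa : 0 < sin (√κ * a) := sin_pos_of_pos_of_lt_pi (by positivity) ha
  rw [one_div, inv_mul_eq_div, le_div_iff₀ hk] at hcomp
  rcases hb0.eq_or_lt with rfl | hbpos
  · have : c = a := by linarith
    subst this
    have e1 : sin (√κ * (c - t)) * cos (√κ * 0) + sin (√κ * t) * cos (√κ * c) =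
        sin (√κ * c) * cos (√κ * t) := by
      rw [mul_sub, sin_sub, mul_zero, cos_zero]; ring
    rw [e1]
    have h1 : √κ * t ≤ π := le_trans (by gcongr) ha.le
    simp only [mul_zero, cos_zero, sin_zero, one_mul, zero_mul, add_zero] at hcomp
    rw [arccos_cos (by positivity) h1] at hcomp
    gcongr
    exact cos_le_cos_of_nonneg_of_le_pi (by positivity) h1 (by linarith)
  · have hsb : 0 < sin (√κ * b) := sin_pos_of_pos_of_lt_pi (by positivity) hb
    set A := cos (√κ * b) * cos (√κ * t) + sin (√κ * b) * sin (√κ * t) *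
        ((cos (√κ * c) - cos (√κ * a) * cos (√κ * b)) /
          (sin (√κ * a) * sin (√κ * b))) with hA
    have hAeq : sin (√κ * (a - t)) * cos (√κ * b) + sin (√κ * t) * cos (√κ * c) =
        sin (√κ * a) * A := by
      rw [hA, mul_sub, sin_sub]; field_simp; ring
    have hst : 0 ≤ sin (√κ * t) :=
      sin_nonneg_of_nonneg_of_le_pi (by positivity) (le_trans (by gcongr) ha.le)
    have hquot : (cos (√κ * c) - cos (√κ * a) * cos (√κ * b)) /
          (sin (√κ * a) * sin (√κ * b)) ≤ 1 := by
      rw [div_le_one (by positivity)]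
      have : cos (√κ * c) ≤ cos (√κ * a - √κ * b) := by
        rw [← cos_abs (√κ * a - √κ * b)]
        apply cos_le_cos_of_nonneg_of_le_pi (abs_nonneg _) hc.le
        rw [abs_le]; constructor <;> nlinarith
      rw [cos_sub] at this
      linarith
    have hA1 : A ≤ 1 := by
      calc A ≤ cos (√κ * b) * cos (√κ * t) + sin (√κ * b) * sin (√κ * t) * 1 := by
            rw [hA]; gcongr
        _ = cos (√κ * b - √κ * t) := by rw [cos_sub]; ring
        _ ≤ 1 := cos_le_one _
    rw [hAeq]
    gcongr
    have h2 : cos (arccos A) ≤ cos (√κ * d) :=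
      cos_le_cos_of_nonneg_of_le_pi (by positivity) (arccos_le_pi _) (by linarith)
    rcases le_or_gt (-1) A with hA2 | hA2
    · rwa [cos_arccos hA2 hA1] at h2
    · exact hA2.le.trans (neg_one_le_cos _)

/-- The subsegment of a geodesic between the parameters `a ≤ b`. -/
def Geodesic.sub {X : Type*} [MetricSpace X] (γ : Geodesic X) {a b : ℝ} (ha : 0 ≤ a)
    (hab : a ≤ b) (hb : b ≤ γ.l) : Geodesic X where
  l := b - a
  l_nonneg := sub_nonneg.2 hab
  map t := γ.map (a + t)
  isom s hs t ht := by
    rw [γ.isom _ ⟨by linarith [hs.1], by linarith [hs.2]⟩ _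
      ⟨by linarith [ht.1], by linarith [ht.2]⟩]
    congr 1; ring

lemma Geodesic.dist_map {X : Type*} [MetricSpace X] (γ : Geodesic X) {s t : ℝ} (hs : 0 ≤ s)
    (hst : s ≤ t) (ht : t ≤ γ.l) : dist (γ.map s) (γ.map t) = t - s := by
  rw [γ.isom s ⟨hs, hst.trans ht⟩ t ⟨hs.trans hst, ht⟩, abs_sub_comm, abs_of_nonneg]
  linarith

lemma IsCATK.cos_midpoint {X : Type*} [MetricSpace X] {κ : ℝ} (hκ : 0 < κ) (h : IsCATK κ X)
    (q : X) (σ : Geodesic X) (hl : 0 < σ.l) (hl' : σ.l < Dk κ / 2)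
    (hb : dist q (σ.map 0) < Dk κ / 2) (hc : dist q (σ.map σ.l) < Dk κ / 2) :
    cos (√κ * dist q (σ.map 0)) + cos (√κ * dist q (σ.map σ.l)) ≤
      2 * cos (√κ * σ.l / 2) * cos (√κ * dist q (σ.map (σ.l / 2))) := by
  have hk : 0 < √κ := Real.sqrt_pos.2 hκ
  have hDk : √κ * Dk κ = π := by unfold Dk; field_simp
  have key := h.stewart hκ q σ hl (by linarith) (t := σ.l / 2) ⟨by linarith, by linarith⟩
  have e1 : σ.l - σ.l / 2 = σ.l / 2 := by ring
  have e2 : √κ * σ.l = 2 * (√κ * (σ.l / 2)) := by ring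
  rw [e1, e2, sin_two_mul] at key
  have e3 : √κ * σ.l / 2 = √κ * (σ.l / 2) := by ring
  rw [e3]
  have hs : 0 < sin (√κ * (σ.l / 2)) := by
    apply sin_pos_of_pos_of_lt_pi (by positivity)
    rw [← hDk]; gcongr; linarith
  refine le_of_mul_le_mul_left ?_ hs
  linarith

lemma IsCATK.dist_midpoint_le {X : Type*} [MetricSpace X] {κ : ℝ} (hκ : 0 < κ)
    (h : IsCATK κ X) (q : X) (σ : Geodesic X) (hl : 0 < σ.l) (hl' : σ.l < Dk κ / 2)
    (hb : dist q (σ.map 0) < Dk κ / 2) (hc : dist q (σ.map σ.l) < Dk κ / 2) :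
    dist q (σ.map (σ.l / 2)) ≤ (dist q (σ.map 0) + dist q (σ.map σ.l)) / 2 := by
  have hk : 0 < √κ := Real.sqrt_pos.2 hκ
  have hDk : √κ * Dk κ = π := by unfold Dk; field_simp
  have key := h.cos_midpoint hκ q σ hl hl' hb hc
  have hlen := σ.dist_map le_rfl σ.l_nonneg le_rfl
  have htri₂ : dist q (σ.map 0) ≤ dist q (σ.map σ.l) + σ.l := by
    have := dist_triangle q (σ.map σ.l) (σ.map 0)
    rw [dist_comm (σ.map σ.l)] at this; linarith
  have htri₃ : dist q (σ.map σ.l) ≤ dist q (σ.map 0) + σ.l := by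
    have := dist_triangle q (σ.map 0) (σ.map σ.l); linarith
  have hd : √κ * dist q (σ.map (σ.l / 2)) < π := by
    have h1 := dist_triangle q (σ.map 0) (σ.map (σ.l / 2))
    rw [σ.dist_map le_rfl (by linarith) (by linarith)] at h1
    rw [← hDk]; gcongr; linarith
  have hb0 : 0 ≤ dist q (σ.map 0) := dist_nonneg
  have hc0 : 0 ≤ dist q (σ.map σ.l) := dist_nonneg
  have hd0 : 0 ≤ dist q (σ.map (σ.l / 2)) := dist_nonneg
  generalize dist q (σ.map 0) = b at *
  generalize dist q (σ.map σ.l) = c at *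
  generalize dist q (σ.map (σ.l / 2)) = d at *
  generalize σ.l = l at *
  by_contra! hlt
  have h1 : cos (√κ * d) < cos ((√κ * b + √κ * c) / 2) := by
    apply cos_lt_cos_of_nonneg_of_le_pi (by positivity) hd.le
    nlinarith
  have hl2 : √κ * l < √κ * (Dk κ / 2) := by gcongr
  have h2 : cos (√κ * l / 2) ≤ cos ((√κ * b - √κ * c) / 2) := by
    rw [← cos_abs ((√κ * b - √κ * c) / 2)]
    apply cos_le_cos_of_nonneg_of_le_pi (abs_nonneg _)
    · nlinarith [pi_pos]
    · rw [abs_le]; constructor <;> nlinarith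
  have h3 : 0 < cos (√κ * l / 2) := by
    apply cos_pos_of_mem_Ioo; constructor <;> nlinarith [pi_pos, mul_pos hk hl]
  have h4 : 0 ≤ cos ((√κ * b + √κ * c) / 2) := by
    have hb2 : √κ * b < √κ * (Dk κ / 2) := by gcongr
    have hc2 : √κ * c < √κ * (Dk κ / 2) := by gcongr
    apply cos_nonneg_of_mem_Icc
    constructor <;> nlinarith [pi_pos, mul_nonneg hk.le hb0, mul_nonneg hk.le hc0]
  rw [cos_add_cos] at key
  nlinarith [mul_lt_mul_of_pos_left h1 h3, mul_le_mul_of_nonneg_left h2 h4]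

lemma IsCATK.dist_midpoint_lt {X : Type*} [MetricSpace X] {κ : ℝ} (hκ : 0 < κ)
    (h : IsCATK κ X) (q : X) (σ : Geodesic X) (hl : 0 < σ.l) (hl' : σ.l < Dk κ / 2)
    (hb : dist q (σ.map 0) < Dk κ / 2) (hbc : dist q (σ.map σ.l) = dist q (σ.map 0)) :
    dist q (σ.map (σ.l / 2)) < dist q (σ.map 0) := by
  have hk : 0 < √κ := Real.sqrt_pos.2 hκ
  have hDk : √κ * Dk κ = π := by unfold Dk; field_simp
  have key := h.cos_midpoint hκ q σ hl hl' hb (hbc ▸ hb)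
  have hle := h.dist_midpoint_le hκ q σ hl hl' hb (hbc ▸ hb)
  rw [hbc] at key hle
  refine lt_of_le_of_ne (by linarith) fun heq => ?_
  rw [heq] at key
  have hb2 : √κ * dist q (σ.map 0) < √κ * (Dk κ / 2) := by gcongr
  have hl2 : √κ * σ.l < √κ * (Dk κ / 2) := by gcongr
  have h0 : 0 ≤ √κ * dist q (σ.map 0) := by positivity
  have hl0 : 0 < √κ * σ.l := by positivity
  have h1 : 0 < cos (√κ * dist q (σ.map 0)) := by
    apply cos_pos_of_mem_Ioo; constructor <;> nlinarith [pi_pos]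
  have h2 : cos (√κ * σ.l / 2) < cos 0 := by
    apply cos_lt_cos_of_nonneg_of_le_pi le_rfl <;> nlinarith [pi_pos]
  rw [cos_zero] at h2
  nlinarith

lemma IsCATK.dist_dyadic_le {X : Type*} [MetricSpace X] {κ : ℝ} (hκ : 0 < κ)
    (h : IsCATK κ X) (q : X) (σ : Geodesic X) (hl : 0 < σ.l) (hl' : σ.l < Dk κ / 2)
    (hb : dist q (σ.map 0) < Dk κ / 2) (hc : dist q (σ.map σ.l) < Dk κ / 2) (n : ℕ) :
    dist q (σ.map ((1 / 2) ^ n * σ.l)) ≤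
      dist q (σ.map 0) + (1 / 2) ^ n * (dist q (σ.map σ.l) - dist q (σ.map 0)) := by
  induction n with
  | zero => simp
  | succ n ih =>
    have hp : (0 : ℝ) < (1 / 2) ^ n := by positivity
    have hp1 : (1 / 2 : ℝ) ^ n ≤ 1 := pow_le_one₀ (by norm_num) (by norm_num)
    have hle : (1 / 2) ^ n * σ.l ≤ σ.l := by nlinarith
    have hmid := h.dist_midpoint_le hκ q
      (σ.sub (a := 0) (b := (1 / 2) ^ n * σ.l) le_rfl (by positivity) hle)
      (by simp only [Geodesic.sub]; rw [sub_zero]; positivity)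
      (by simp only [Geodesic.sub]; linarith)
      (by simpa [Geodesic.sub] using hb)
      (by simp only [Geodesic.sub, sub_zero, zero_add]; nlinarith)
    simp only [Geodesic.sub, sub_zero, zero_add] at hmid
    rw [pow_succ, show (1 / 2 : ℝ) ^ n * (1 / 2) * σ.l = (1 / 2) ^ n * σ.l / 2 by ring]
    linarith

/-- First-order consequence of an optimality condition along the dyadic points of a geodesic `η`:
the one-sided derivative at `η 0` of the distance to a point `γ e` is controlled by the increment
along `η` of the distance to the endpoint of `γ`. -/
lemma IsCATK.dyadic_first_order {X : Type*} [MetricSpace X] {κ : ℝ} (hκ : 0 < κ)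
    (h : IsCATK κ X) (γ η : Geodesic X) (h0 : η.map 0 = γ.map 0) (hγ : 0 < γ.l) (hη : 0 < η.l)
    (hlen : γ.l + η.l < Dk κ / 2) {e : ℝ} (he : e ∈ Set.Icc 0 γ.l) {B T : ℝ} (hT : 0 ≤ T)
    (hopt : ∀ᶠ n : ℕ in atTop,
      T * (cos (√κ * dist (γ.map e) (η.map ((1 / 2) ^ n * η.l))) - cos (√κ * e)) ≤
        (1 / 2) ^ n * B) :
    -(T * √κ * sin (√κ * e)) * (dist (γ.map γ.l) (η.map η.l) - γ.l) ≤ B := by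
  have hk : 0 < √κ := Real.sqrt_pos.2 hκ
  have hDk : √κ * Dk κ = π := by unfold Dk; field_simp
  have hγlen := γ.dist_map le_rfl γ.l_nonneg le_rfl
  have hηlen := η.dist_map le_rfl η.l_nonneg le_rfl
  have hb : dist (γ.map γ.l) (η.map 0) = γ.l := by rw [h0, dist_comm]; linarith
  have hc : dist (γ.map γ.l) (η.map η.l) ≤ γ.l + η.l := by
    have := dist_triangle (γ.map γ.l) (η.map 0) (η.map η.l); linarith
  set c := dist (γ.map γ.l) (η.map η.l) with hcdef
  have hsin : 0 < sin (√κ * γ.l) := by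
    apply sin_pos_of_pos_of_lt_pi (by positivity); rw [← hDk]; gcongr; linarith
  have hsine : 0 ≤ sin (√κ * e) := by
    apply sin_nonneg_of_nonneg_of_le_pi (mul_nonneg hk.le he.1)
    rw [← hDk]; gcongr; linarith [he.2]
  let φ : ℝ → ℝ := fun u => sin (√κ * (γ.l - e)) * cos (√κ * (u * η.l)) +
    sin (√κ * e) * cos (√κ * (γ.l + u * (c - γ.l)))
  have hφ0 : φ 0 = sin (√κ * γ.l) * cos (√κ * e) := by
    simp only [φ, zero_mul, mul_zero, cos_zero, add_zero, mul_one]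
    rw [mul_sub, sin_sub]; ring
  have hφ : HasDerivAt φ (-(sin (√κ * e) * sin (√κ * γ.l) * (√κ * (c - γ.l)))) 0 := by
    have h1 : HasDerivAt (fun u : ℝ => √κ * (u * η.l)) (√κ * (1 * η.l)) 0 :=
      ((hasDerivAt_id (0 : ℝ)).mul_const _).const_mul _
    have h2 : HasDerivAt (fun u : ℝ => √κ * (γ.l + u * (c - γ.l))) (√κ * (1 * (c - γ.l))) 0 :=
      (((hasDerivAt_id (0 : ℝ)).mul_const _).const_add _).const_mul _
    have h3 : HasDerivAt φ _ 0 :=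
      (h1.cos.const_mul (sin (√κ * (γ.l - e)))).add (h2.cos.const_mul (sin (√κ * e)))
    refine h3.congr_deriv ?_
    simp only [zero_mul, mul_zero, sin_zero, neg_zero, add_zero]
    ring
  have hu : Tendsto (fun n : ℕ => (1 / 2 : ℝ) ^ n) atTop (nhdsWithin 0 {0}ᶜ) := by
    refine tendsto_nhdsWithin_iff.2 ⟨tendsto_pow_atTop_nhds_zero_of_lt_one (by norm_num)
      (by norm_num), Eventually.of_forall fun n => ?_⟩
    simp
  have hlim := (hasDerivAt_iff_tendsto_slope.1 hφ).comp hu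
  have hlim2 := hlim.const_mul T
  have hfin : T * -(sin (√κ * e) * sin (√κ * γ.l) * (√κ * (c - γ.l))) ≤
      sin (√κ * γ.l) * B := by
    refine le_of_tendsto hlim2 ?_
    filter_upwards [hopt] with n hn
    have hp : (0 : ℝ) < (1 / 2) ^ n := by positivity
    have hp1 : (1 / 2 : ℝ) ^ n ≤ 1 := pow_le_one₀ (by norm_num) (by norm_num)
    have hdy := h.dist_dyadic_le hκ (γ.map γ.l) η hη (by linarith) (by linarith) (by linarith) n
    rw [hb, ← hcdef] at hdy
    set u : ℝ := (1 / 2) ^ n with hu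
    have hul : u * η.l ≤ η.l := by nlinarith
    have hq0 : dist (η.map (u * η.l)) (γ.map 0) = u * η.l := by
      rw [← h0, dist_comm, η.dist_map le_rfl (by positivity) hul]; ring
    have hmax : γ.l + u * (c - γ.l) ≤ γ.l + η.l := by nlinarith
    have hst := h.stewart hκ (η.map (u * η.l)) γ hγ
      (by rw [hq0, dist_comm _ (γ.map γ.l)]; linarith) he
    rw [hq0, dist_comm _ (γ.map γ.l), dist_comm _ (γ.map e)] at hst
    have hcos : cos (√κ * (γ.l + u * (c - γ.l))) ≤
        cos (√κ * dist (γ.map γ.l) (η.map (u * η.l))) := by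
      apply cos_le_cos_of_nonneg_of_le_pi (by positivity)
      · rw [← hDk]; gcongr; linarith
      · gcongr
    have hφu : φ u ≤ sin (√κ * γ.l) * cos (√κ * dist (γ.map e) (η.map (u * η.l))) := by
      have := mul_le_mul_of_nonneg_left hcos hsine
      simp only [φ]; linarith
    simp only [Function.comp, slope_def_field, sub_zero]
    rw [mul_div_assoc', div_le_iff₀ hp, hφ0]
    calc T * (φ u - sin (√κ * γ.l) * cos (√κ * e))
        ≤ T * (sin (√κ * γ.l) * cos (√κ * dist (γ.map e) (η.map (u * η.l))) -
          sin (√κ * γ.l) * cos (√κ * e)) := by gcongr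
      _ = sin (√κ * γ.l) *
          (T * (cos (√κ * dist (γ.map e) (η.map (u * η.l))) - cos (√κ * e))) := by ring
      _ ≤ sin (√κ * γ.l) * (u * B) := by gcongr
      _ = _ := by ring
  refine le_of_mul_le_mul_left ?_ hsin
  linarith

lemma GConvexFn.toReal_le {X : Type*} [MetricSpace X] {f : X → EReal} (hf : GConvexFn f)
    (hbot : ∀ y, f y ≠ ⊥) (γ : Geodesic X) (h0 : f (γ.map 0) ≠ ⊤) (hl : f (γ.map γ.l) ≠ ⊤)
    {s : ℝ} (hs : s ∈ Set.Icc (0 : ℝ) 1) :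
    (f (γ.map (s * γ.l))).toReal ≤
      (1 - s) * (f (γ.map 0)).toReal + s * (f (γ.map γ.l)).toReal := by
  have h := hf γ s hs
  rw [← EReal.coe_toReal h0 (hbot _), ← EReal.coe_toReal hl (hbot _)] at h
  rw [← EReal.coe_mul, ← EReal.coe_mul, ← EReal.coe_add] at h
  have := EReal.toReal_le_toReal h (hbot _) (EReal.coe_ne_top _)
  rwa [EReal.toReal_coe] at this

/-- A convex function that is bounded near `x` is Lipschitz near `x`. -/
lemma GConvexFn.toReal_sub_le {X : Type*} [MetricSpace X] {R : ℝ} {f : X → EReal}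
    (hf : GConvexFn f) (hbot : ∀ y, f y ≠ ⊥) {x : X} (hext : GeodExtAround x R) {δ : ℝ}
    (hδ : 0 < δ) (hδR : 8 * δ ≤ R)
    (hbd : ∀ y ∈ closedBall x (2 * δ), f y ≠ ⊤ ∧ |(f y).toReal - (f x).toReal| ≤ 1)
    {y z : X} (hy : y ∈ closedBall x δ) (hz : z ∈ closedBall x δ) :
    (f z).toReal - (f y).toReal ≤ 2 / δ * dist y z := by
  rcases eq_or_ne y z with rfl | hyz
  · simp
  rw [mem_closedBall] at hy hz
  have hd : dist y z ≤ 2 * δ := by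
    have := dist_triangle_right y z x; linarith
  have hd0 : 0 < dist y z := dist_pos.2 hyz
  obtain ⟨γ, hγl, hγ0, hγ1⟩ := hext y z (by rw [mem_ball]; linarith) (by rw [mem_ball]; linarith)
    hyz (by linarith)
  set d := dist y z
  have hv : dist (γ.map (d + δ)) x ≤ 2 * δ := by
    have h1 := γ.dist_map hd0.le (show d ≤ d + δ by linarith) (by linarith)
    have h2 := dist_triangle_left (γ.map (d + δ)) x z
    rw [hγ1] at h1; linarith
  have hyb := hbd y (by rw [mem_closedBall]; linarith)
  have hvb := hbd (γ.map (d + δ)) (by rw [mem_closedBall]; linarith)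
  have key := hf.toReal_le hbot (γ.sub (a := 0) (b := d + δ) le_rfl (by positivity) (by linarith))
    (by simpa [Geodesic.sub, hγ0] using hyb.1) (by simpa [Geodesic.sub] using hvb.1)
    (s := d / (d + δ)) ⟨by positivity, by rw [div_le_one (by positivity)]; linarith⟩
  simp only [Geodesic.sub, zero_add, sub_zero, hγ0] at key
  rw [div_mul_cancel₀ _ (by positivity), hγ1] at key
  have hdiff : (f (γ.map (d + δ))).toReal - (f y).toReal ≤ 2 := by
    have h1 := abs_le.1 hyb.2
    have h2 := abs_le.1 hvb.2
    linarith [h1.1, h2.2]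
  have hs : d / (d + δ) ≤ d / δ := by gcongr; linarith
  have hs0 : 0 ≤ d / (d + δ) := by positivity
  calc (f z).toReal - (f y).toReal
      ≤ d / (d + δ) * ((f (γ.map (d + δ))).toReal - (f y).toReal) := by linarith
    _ ≤ d / (d + δ) * 2 := by gcongr
    _ ≤ d / δ * 2 := by gcongr
    _ = 2 / δ * d := by ring

lemma Standing.exists_geodesic {X : Type*} [MetricSpace X] {κ : ℝ} {R : X → ℝ}
    (hX : Standing κ X R) {p y : X} (hpy : p ≠ y) :
    ∃ η : Geodesic X, η.map 0 = p ∧ η.map η.l = y ∧ η.l = dist p y ∧ 0 < η.l := by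
  obtain ⟨η, h0, hl, h1⟩ := hX.geod p y
  exact ⟨η, h0, h1, hl, hl ▸ dist_pos.2 hpy⟩

/-- A minimizer `p` of a penalization of `f` by the distance to `x` satisfies a first-order
condition along any geodesic `γ` issuing from `p` and passing through `x`. -/
lemma Standing.first_order_of_isMinOn {X : Type*} [MetricSpace X] {κ : ℝ} {R : X → ℝ}
    (hX : Standing κ X R) {f : X → EReal} (hbot : ∀ y, f y ≠ ⊥) (hconv : GConvexFn f)
    {x : X} {δ : ℝ} (hδR : 8 * δ ≤ R x) (hfin : ∀ y ∈ closedBall x δ, f y ≠ ⊤)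
    {T : ℝ} (hT : 0 ≤ T) {p : X} (hp : dist p x < δ)
    (hmin : ∀ q ∈ closedBall x δ, (f p).toReal - T * cos (√κ * dist x p) ≤
      (f q).toReal - T * cos (√κ * dist x q))
    (γ : Geodesic X) (hγ0 : γ.map 0 = p) (hγ : 0 < γ.l) (hγl : γ.l ≤ 2 * δ)
    (hle : dist x p ≤ γ.l) (hγx : γ.map (dist x p) = x) {y : X} (hy : y ∈ closedBall x δ)
    (hpy : p ≠ y) :
    -(T * √κ * sin (√κ * dist x p)) * (dist (γ.map γ.l) y - γ.l) ≤
      (f y).toReal - (f p).toReal := by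
  obtain ⟨η, hη0, hη1, hηl, hη⟩ := hX.exists_geodesic hpy
  have hy' := mem_closedBall.1 hy
  have hlen : η.l ≤ 2 * δ := by
    have := dist_triangle_right p y x; linarith
  have key := hX.cat.dyadic_first_order hX.kpos γ η (hη0.trans hγ0.symm) hγ hη
    (by have := hX.Rsmall x; linarith) (e := dist x p) ⟨dist_nonneg, hle⟩
    (B := (f y).toReal - (f p).toReal) hT ?_
  · rwa [hη1] at key
  have hlim : Tendsto (fun n : ℕ => dist p x + (1 / 2 : ℝ) ^ n * η.l) atTop
      (nhds (dist p x + 0 * η.l)) :=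
    ((tendsto_pow_atTop_nhds_zero_of_lt_one (by norm_num) (by norm_num)).mul_const _).const_add _
  have hev := hlim.eventually_lt_const (u := δ) (by linarith)
  filter_upwards [hev] with n hn
  have hu0 : (0 : ℝ) < (1 / 2) ^ n := by positivity
  have hu1 : (1 / 2 : ℝ) ^ n ≤ 1 := pow_le_one₀ (by norm_num) (by norm_num)
  set u : ℝ := (1 / 2) ^ n
  have hq : η.map (u * η.l) ∈ closedBall x δ := by
    rw [mem_closedBall]
    have h1 := η.dist_map le_rfl (show 0 ≤ u * η.l by positivity) (by nlinarith)
    have h2 := dist_triangle_left (η.map (u * η.l)) x p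
    rw [hη0] at h1; linarith
  have hc := hconv.toReal_le hbot η (by rw [hη0]; exact hfin p (mem_closedBall.2 hp.le))
    (by rw [hη1]; exact hfin y hy) (s := u) ⟨hu0.le, hu1⟩
  have hm := hmin _ hq
  rw [hη0, hη1] at hc
  rw [hγx]
  linarith

/-- Up to an error `ε`, the point `x` minimizes on a small ball the sum of `f` and a multiple of the
distance to some point `w` with `d(x, w) = δ`. -/
lemma Standing.exists_approx {X : Type*} [MetricSpace X] {κ : ℝ} {R : X → ℝ}
    (hX : Standing κ X R) {f : X → EReal} (hbot : ∀ y, f y ≠ ⊥) (hconv : GConvexFn f)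
    {x : X} {δ : ℝ} (hδ : 0 < δ) (hδR : 8 * δ ≤ R x) (hcpt : IsCompact (closedBall x δ))
    (hfin : ∀ y ∈ closedBall x δ, f y ≠ ⊤) {L : ℝ} (hL : 0 < L)
    (hlip : ∀ y ∈ closedBall x δ, ∀ z ∈ closedBall x δ,
      (f z).toReal - (f y).toReal ≤ L * dist y z)
    (hnot : ∃ y ∈ closedBall x δ, (f y).toReal < (f x).toReal)
    {ε : ℝ} (hε : 0 < ε) :
    ∃ (w : X) (a : ℝ), dist x w = δ ∧ a ∈ Set.Icc 0 (π * L) ∧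
      ∀ y ∈ closedBall x δ, (f x).toReal + a * δ - ε ≤ (f y).toReal + a * dist w y := by
  have hk : 0 < √κ := Real.sqrt_pos.2 hX.kpos
  have hDk : √κ * Dk κ = π := by unfold Dk; field_simp
  have hxmem : x ∈ closedBall x δ := mem_closedBall_self hδ.le
  set m := min (ε / L) δ with hm
  have hmpos : 0 < m := lt_min (by positivity) hδ
  set T := π ^ 2 * L / (√κ ^ 2 * m) with hTdef
  have hT : 0 < T := by have := pi_pos; positivity
  have hcont : ContinuousOn (fun y => (f y).toReal - T * cos (√κ * dist x y))
      (closedBall x δ) := by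
    refine ContinuousOn.sub ?_ (by fun_prop)
    refine (LipschitzOnWith.of_dist_le_mul (K := L.toNNReal) fun y hy z hz => ?_).continuousOn
    rw [Real.coe_toNNReal _ hL.le, Real.dist_eq, abs_le]
    have h1 := hlip y hy z hz
    have h2 := hlip z hz y hy
    rw [dist_comm z] at h2
    constructor <;> linarith
  obtain ⟨p, hp, hpmin⟩ := hcpt.exists_isMinOn ⟨x, hxmem⟩ hcont
  have hmin : ∀ q ∈ closedBall x δ, (f p).toReal - T * cos (√κ * dist x p) ≤
      (f q).toReal - T * cos (√κ * dist x q) := fun q hq => hpmin hq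
  have hpx : p ≠ x := by
    rintro rfl
    obtain ⟨y, hy, hlt⟩ := hnot
    have hpy : p ≠ y := by rintro rfl; exact lt_irrefl _ hlt
    obtain ⟨η, hη0, hη1, hηl, hη⟩ := hX.exists_geodesic hpy
    have := hX.first_order_of_isMinOn hbot hconv hδR hfin hT.le (by simpa using hδ) hmin η hη0 hη
      (by rw [hηl, dist_comm]; linarith [mem_closedBall.1 hy]) (by simpa using hη.le)
      (by simpa using hη0) hy hpy
    simp only [dist_self, mul_zero, sin_zero, neg_zero, zero_mul] at this
    linarith
  have hp' := mem_closedBall'.1 hp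
  set e := dist x p with he
  have hepos : 0 < e := dist_pos.2 hpx.symm
  have hke : √κ * e < π / 2 := by
    have : √κ * e < √κ * (Dk κ / 2) := by
      gcongr; have := hX.Rsmall x; linarith
    linarith
  have hsin := mul_le_sin (show 0 ≤ √κ * e by positivity) hke.le
  have hsinpos : 0 < sin (√κ * e) :=
    sin_pos_of_pos_of_lt_pi (by positivity) (by linarith [pi_pos])
  have hee : e ≤ π / (2 * √κ) * sin (√κ * e) := by
    calc e = π / (2 * √κ) * (2 / π * (√κ * e)) := by
          have := pi_ne_zero; field_simp
      _ ≤ _ := by have := pi_pos; gcongr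
  have hFx := hmin x hxmem
  rw [dist_self, mul_zero, cos_zero] at hFx
  have hlipx := hlip p hp x hxmem
  rw [dist_comm, ← he] at hlipx
  have hsq : T * sin (√κ * e) ^ 2 ≤ L * π / √κ * sin (√κ * e) := by
    have h1 : sin (√κ * e) ^ 2 ≤ 2 * (1 - cos (√κ * e)) := by
      nlinarith [sin_sq_add_cos_sq (√κ * e), sq_nonneg (1 - cos (√κ * e))]
    calc T * sin (√κ * e) ^ 2 ≤ T * (2 * (1 - cos (√κ * e))) := by gcongr
      _ ≤ 2 * (L * e) := by linarith
      _ ≤ 2 * (L * (π / (2 * √κ) * sin (√κ * e))) := by gcongr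
      _ = _ := by field_simp
  have hTs : T * sin (√κ * e) ≤ L * π / √κ := by
    refine le_of_mul_le_mul_right ?_ hsinpos
    linarith
  have haL : T * √κ * sin (√κ * e) ≤ π * L := by
    calc T * √κ * sin (√κ * e) = √κ * (T * sin (√κ * e)) := by ring
      _ ≤ √κ * (L * π / √κ) := by gcongr
      _ = π * L := by field_simp
  have hem : e ≤ m / 2 := by
    have h1 : sin (√κ * e) ≤ √κ * m / π := by
      refine le_of_mul_le_mul_left (hTs.trans_eq ?_) hT
      rw [hTdef]; have := pi_ne_zero; field_simp
    calc e ≤ π / (2 * √κ) * (√κ * m / π) := by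
          refine hee.trans ?_; have := pi_pos; gcongr
      _ = m / 2 := by have := pi_ne_zero; field_simp
  have heδ : e < δ := by have := min_le_right (ε / L) δ; linarith
  have heε : L * e ≤ ε := by
    have h1 : e ≤ ε / L := by have := min_le_left (ε / L) δ; linarith
    rw [le_div_iff₀ hL] at h1; linarith
  obtain ⟨γ, hγl, hγ0, hγ1⟩ := hX.ext x p x (by rw [mem_ball']; linarith)
    (mem_ball_self (hX.Rpos x)) hpx (by rw [dist_comm]; linarith)
  rw [dist_comm, ← he] at hγ1
  have hw : dist x (γ.map (e + δ)) = δ := by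
    have := γ.dist_map hepos.le (show e ≤ e + δ by linarith) (by linarith)
    rw [hγ1] at this; linarith
  refine ⟨γ.map (e + δ), T * √κ * sin (√κ * e), hw, ⟨by positivity, haL⟩, fun y hy => ?_⟩
  have hstep : (f p).toReal + T * √κ * sin (√κ * e) * (e + δ) ≤
      (f y).toReal + T * √κ * sin (√κ * e) * dist (γ.map (e + δ)) y := by
    rcases eq_or_ne p y with rfl | hpy
    · have := γ.dist_map le_rfl (show 0 ≤ e + δ by linarith) (by linarith)
      rw [hγ0, dist_comm] at this
      rw [this, sub_zero]
    · have := hX.first_order_of_isMinOn hbot hconv hδR hfin hT.le (by rwa [dist_comm]) hmin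
        (γ.sub (a := 0) (b := e + δ) le_rfl (by positivity) (by linarith))
        (by simpa [Geodesic.sub] using hγ0) (by simp only [Geodesic.sub]; linarith)
        (by simp only [Geodesic.sub]; linarith) (by simp only [Geodesic.sub]; linarith)
        (by simpa [Geodesic.sub] using hγ1) hy hpy
      simp only [Geodesic.sub, zero_add, sub_zero] at this
      linarith
  have : 0 ≤ T * √κ * sin (√κ * e) * e := by positivity
  linarith

/-- The point `x` minimizes on a small ball the sum of `f` and a multiple of the distance to some
point `w` with `d(x, w) = δ`. -/
lemma Standing.exists_dist_minimizer {X : Type*} [MetricSpace X] {κ : ℝ} {R : X → ℝ}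
    (hX : Standing κ X R) {f : X → EReal} (hbot : ∀ y, f y ≠ ⊥) (hconv : GConvexFn f)
    {x : X} {δ : ℝ} (hδ : 0 < δ) (hδR : 8 * δ ≤ R x) (hcpt : IsCompact (closedBall x δ))
    (hfin : ∀ y ∈ closedBall x δ, f y ≠ ⊤) {L : ℝ} (hL : 0 < L)
    (hlip : ∀ y ∈ closedBall x δ, ∀ z ∈ closedBall x δ,
      (f z).toReal - (f y).toReal ≤ L * dist y z)
    (hnot : ∃ y ∈ closedBall x δ, (f y).toReal < (f x).toReal) :
    ∃ (w : X) (a : ℝ), dist x w = δ ∧ 0 ≤ a ∧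
      ∀ y ∈ closedBall x δ, (f x).toReal + a * δ ≤ (f y).toReal + a * dist w y := by
  have happ : ∀ n : ℕ, ∃ v : X × ℝ, dist x v.1 = δ ∧ v.2 ∈ Set.Icc 0 (π * L) ∧
      ∀ y ∈ closedBall x δ,
        (f x).toReal + v.2 * δ - 1 / ((n : ℝ) + 1) ≤ (f y).toReal + v.2 * dist v.1 y := by
    intro n
    obtain ⟨w, a, h⟩ := hX.exists_approx hbot hconv hδ hδR hcpt hfin hL hlip hnot
      (ε := 1 / ((n : ℝ) + 1)) (by positivity)
    exact ⟨(w, a), h⟩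
  choose v hvd hva hv using happ
  obtain ⟨⟨w, a⟩, hwa, φ, hφ, hlim⟩ :=
    (hcpt.prod (isCompact_Icc (a := (0 : ℝ)) (b := π * L))).tendsto_subseq (x := v)
      fun n => ⟨mem_closedBall'.2 (hvd n).le, hva n⟩
  have hlim1 : Tendsto (fun n => (v (φ n)).1) atTop (nhds w) :=
    (continuous_fst.tendsto _).comp hlim
  have hlim2 : Tendsto (fun n => (v (φ n)).2) atTop (nhds a) :=
    (continuous_snd.tendsto _).comp hlim
  refine ⟨w, a, ?_, hwa.2.1, fun y hy => ?_⟩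
  · refine tendsto_nhds_unique (tendsto_const_nhds.dist hlim1) ?_
    simp only [hvd]
    exact tendsto_const_nhds
  · have h0 : Tendsto (fun n => 1 / ((φ n : ℝ) + 1)) atTop (nhds 0) :=
      tendsto_one_div_add_atTop_nhds_zero_nat.comp hφ.tendsto_atTop
    have hl := ((hlim2.mul_const δ).const_add (f x).toReal).sub h0
    rw [sub_zero] at hl
    exact le_of_tendsto_of_tendsto' hl
      ((hlim2.mul (hlim1.dist tendsto_const_nhds)).const_add _) fun n => hv (φ n) y hy

lemma dist_toXR {X : Type*} [MetricSpace X] (x y : X) (a b : ℝ) :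
    dist (toXR x a) (toXR y b) = √(dist x y ^ 2 + (a - b) ^ 2) := by
  rw [WithLp.prod_dist_eq_add (by simp), Real.sqrt_eq_rpow]
  simp [toXR, Real.dist_eq]

/-- The geodesic of `X × ℝ` with horizontal part `γ` and slope `-1 / r`. -/
def descentGeod {X : Type*} [MetricSpace X] (γ : Geodesic X) {r R₀ : ℝ} (hr : 0 ≤ r)
    (hR : 0 ≤ R₀) (hγ : r * R₀ / √(r ^ 2 + 1) ≤ γ.l) (b : ℝ) : Geodesic (XR X) where
  l := R₀
  l_nonneg := hR
  map t := toXR (γ.map (r * t / √(r ^ 2 + 1))) (b - t / √(r ^ 2 + 1))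
  isom s hs t ht := by
    have hq : 0 < √(r ^ 2 + 1) := by positivity
    have hmem : ∀ u ∈ Set.Icc 0 R₀, r * u / √(r ^ 2 + 1) ∈ Set.Icc 0 γ.l := by
      intro u hu
      have := hu.1
      refine ⟨by positivity, le_trans ?_ hγ⟩
      have := hu.2
      gcongr
    rw [dist_toXR, γ.isom _ (hmem s hs) _ (hmem t ht), sq_abs]
    have h2 : √(r ^ 2 + 1) ^ 2 = r ^ 2 + 1 := Real.sq_sqrt (by positivity)
    have : (r * s / √(r ^ 2 + 1) - r * t / √(r ^ 2 + 1)) ^ 2 +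
        (b - s / √(r ^ 2 + 1) - (b - t / √(r ^ 2 + 1))) ^ 2 = (s - t) ^ 2 := by
      field_simp
      rw [h2]; ring
    rw [this, Real.sqrt_sq_eq_abs]

/-- A criterion for `(x, f x)` to be the unique point of the epigraph nearest to `(w, b)`. -/
lemma projSet_epigraph_eq {X : Type*} [MetricSpace X] {f : X → EReal} {x : X}
    (hbot : ∀ y, f y ≠ ⊥) (hx : f x < ⊤) {w : X} {b : ℝ}
    (hle : ∀ y (l : ℝ), f y ≤ l →
      dist w x ^ 2 + (b - (f x).toReal) ^ 2 ≤ dist w y ^ 2 + (b - l) ^ 2)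
    (heq : ∀ y (l : ℝ), f y ≤ l →
      dist w y ^ 2 + (b - l) ^ 2 = dist w x ^ 2 + (b - (f x).toReal) ^ 2 →
      y = x ∧ l = (f x).toReal) :
    projSet (epigraph f) (toXR w b) = {toXR x (f x).toReal} := by
  have hsurj : ∀ c : XR X, ∃ y l, c = toXR y l := fun c => ⟨c.fst, c.snd, rfl⟩
  have hmem : ∀ y (l : ℝ), toXR y l ∈ epigraph f ↔ f y ≤ l := fun y l => Iff.rfl
  have hxmem : toXR x (f x).toReal ∈ epigraph f := by
    rw [hmem, EReal.coe_toReal hx.ne (hbot x)]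
  have hnear : ∀ c ∈ epigraph f, dist (toXR w b) (toXR x (f x).toReal) ≤ dist (toXR w b) c := by
    intro c hc
    obtain ⟨y, l, rfl⟩ := hsurj c
    rw [dist_toXR, dist_toXR]
    exact Real.sqrt_le_sqrt (hle y l ((hmem y l).1 hc))
  ext c
  rw [mem_singleton_iff]
  constructor
  · rintro ⟨hc, hcmin⟩
    have h := le_antisymm (hcmin _ hxmem) (hnear c hc)
    obtain ⟨y, l, rfl⟩ := hsurj c
    rw [dist_toXR, dist_toXR, Real.sqrt_inj (by positivity) (by positivity)] at h
    obtain ⟨rfl, rfl⟩ := heq y l ((hmem y l).1 hc) h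
    rfl
  · rintro rfl
    exact ⟨hxmem, hnear⟩

/-- A local minimizer has the origin as a subgradient. -/
lemma isSubgrad_of_local_min {X : Type*} [MetricSpace X] {f : X → EReal} {x : X} {R₀ : ℝ}
    (hbot : ∀ y, f y ≠ ⊥) (hx : f x < ⊤) {δ : ℝ} (hδ : 0 < δ) (hδR : δ ≤ R₀)
    (hmin : ∀ y ∈ closedBall x δ, ∀ l : ℝ, f y ≤ l → (f x).toReal ≤ l) :
    IsSubgrad R₀ f x (constGeod x) 0 := by
  refine ⟨descentGeod (constGeod x) le_rfl (hδ.le.trans hδR) (by simp [constGeod]) (f x).toReal,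
    rfl, fun t => rfl, Or.inr ⟨δ, hδ, hδR, ?_⟩⟩
  have hmap : (descentGeod (constGeod x) (r := 0) le_rfl (hδ.le.trans hδR)
      (by simp [constGeod]) (f x).toReal).map δ = toXR x ((f x).toReal - δ) := by
    simp [descentGeod, constGeod]
  rw [hmap]
  apply projSet_epigraph_eq hbot hx
  · intro y l hl
    rw [dist_self]
    by_cases hy : y ∈ closedBall x δ
    · have := hmin y hy l hl
      nlinarith [sq_nonneg (dist x y)]
    · rw [mem_closedBall', not_le] at hy
      nlinarith [sq_nonneg ((f x).toReal - δ - l)]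
  · intro y l hl h
    rw [dist_self] at h
    by_cases hy : y ∈ closedBall x δ
    · have := hmin y hy l hl
      have hl' : l = (f x).toReal := by nlinarith [sq_nonneg (dist x y)]
      subst hl'
      have : dist x y = 0 := by
        have : dist x y ^ 2 = 0 := by linarith
        exact pow_eq_zero_iff (two_ne_zero) |>.1 this
      exact ⟨(dist_eq_zero.1 this).symm, rfl⟩
    · rw [mem_closedBall', not_le] at hy
      nlinarith [sq_nonneg ((f x).toReal - δ - l)]

/-- If `x` locally minimizes the sum of `f` and `a` times the distance to `w`, then a geodesic from
`x` through `w` gives a subgradient of length `a`. -/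
lemma Standing.exists_subgrad_of_dist_minimizer {X : Type*} [MetricSpace X] {κ : ℝ} {R : X → ℝ}
    (hX : Standing κ X R) {f : X → EReal} (hbot : ∀ y, f y ≠ ⊥) {x : X} (hx : f x < ⊤)
    {δ : ℝ} (hδ : 0 < δ) (hδR : 8 * δ ≤ R x) (hfin : ∀ y ∈ closedBall x δ, f y ≠ ⊤)
    (hconv : GConvexFn f) {w : X} {a : ℝ} (ha : 0 < a) (hw : dist x w = δ)
    (hmin : ∀ y ∈ closedBall x δ, (f x).toReal + a * δ ≤ (f y).toReal + a * dist w y) :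
    ∃ γ : Geodesic X, InTangent x γ a ∧ IsSubgrad (R x) f x γ a := by
  have hR := hX.Rpos x
  have hxw : x ≠ w := by rintro rfl; rw [dist_self] at hw; exact hδ.ne hw
  obtain ⟨γ, hγl, hγ0, hγw⟩ := hX.ext x x w (mem_ball_self hR)
    (by rw [mem_ball']; linarith) hxw (by linarith)
  rw [hw] at hγw
  have hq : 0 < √(a ^ 2 + 1) := by positivity
  have hq2 : √(a ^ 2 + 1) ^ 2 = a ^ 2 + 1 := Real.sq_sqrt (by positivity)
  have hγlen : a * R x / √(a ^ 2 + 1) ≤ γ.l := by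
    rw [hγl, div_le_iff₀ hq]
    have : a ≤ √(a ^ 2 + 1) := Real.le_sqrt_of_sq_le (by linarith)
    nlinarith
  refine ⟨γ, ⟨hγ0, ha.le, Or.inr (by linarith)⟩,
    descentGeod γ ha.le hR.le hγlen (f x).toReal, rfl, fun t => rfl, Or.inr ?_⟩
  set h := δ / (4 * (1 + a)) with hh
  have hhpos : 0 < h := by positivity
  have hsum : h + a * h = δ / 4 := by rw [hh]; field_simp
  have hah : 0 < a * h := by positivity
  have hqle : √(a ^ 2 + 1) ≤ 1 + a := by
    rw [Real.sqrt_le_left (by positivity)]; nlinarith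
  refine ⟨h * √(a ^ 2 + 1), by positivity, ?_, ?_⟩
  · change _ ≤ R x
    nlinarith
  have hmap : (descentGeod γ ha.le hR.le hγlen (f x).toReal).map (h * √(a ^ 2 + 1)) =
      toXR (γ.map (a * h)) ((f x).toReal - h) := by
    simp only [descentGeod]
    congr 2
    · field_simp
    · field_simp
  rw [hmap]
  have hwx : dist (γ.map (a * h)) x = a * h := by
    have := γ.dist_map le_rfl hah.le (by linarith)
    rw [hγ0, dist_comm] at this; linarith
  have hww : dist w (γ.map (a * h)) = δ - a * h := by
    have := γ.dist_map hah.le (show a * h ≤ δ by linarith) (by linarith)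
    rw [hγw, dist_comm] at this; exact this
  set w' := γ.map (a * h)
  have hmin' : ∀ y ∈ closedBall x δ, (f x).toReal + a * (a * h) ≤ (f y).toReal + a * dist w' y := by
    intro y hy
    have h1 := hmin y hy
    have h2 := mul_le_mul_of_nonneg_left (dist_triangle w w' y) ha.le
    rw [hww] at h2
    linarith
  have hreal : ∀ y ∈ closedBall x δ, ∀ l : ℝ, f y ≤ l → (f y).toReal ≤ l := by
    intro y hy l hl
    have := EReal.toReal_le_toReal hl (hbot y) (EReal.coe_ne_top l)
    rwa [EReal.toReal_coe] at this
  have hfar : ∀ y ∉ closedBall x δ, (a * h) ^ 2 + h ^ 2 < dist w' y ^ 2 := by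
    intro y hy
    rw [mem_closedBall', not_le] at hy
    have h1 := dist_triangle_left x y w'
    nlinarith
  have hCS : ∀ d u : ℝ, a * (a * h) + h ≤ u + a * d →
      (a * h) ^ 2 + h ^ 2 + (d - a * u) ^ 2 / (a ^ 2 + 1) ≤ d ^ 2 + u ^ 2 := by
    intro d u hdu
    have h0 : 0 < a * (a * h) + h := by positivity
    have h1 : (a * (a * h) + h) ^ 2 ≤ (u + a * d) ^ 2 := by gcongr
    have h2 : d ^ 2 + u ^ 2 = (u + a * d) ^ 2 / (a ^ 2 + 1) + (d - a * u) ^ 2 / (a ^ 2 + 1) := by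
      field_simp; ring
    have h3 : (a * h) ^ 2 + h ^ 2 = (a * (a * h) + h) ^ 2 / (a ^ 2 + 1) := by
      field_simp
    rw [h2, h3]
    gcongr
  apply projSet_epigraph_eq hbot hx
  · intro y l hl
    rw [hwx]
    by_cases hy : y ∈ closedBall x δ
    · have h1 := hCS (dist w' y) (l - (f x).toReal + h)
        (by linarith [hmin' y hy, hreal y hy l hl])
      have h2 : 0 ≤ (dist w' y - a * (l - (f x).toReal + h)) ^ 2 / (a ^ 2 + 1) := by positivity
      linarith
    · linarith [hfar y hy, sq_nonneg ((f x).toReal - h - l)]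
  · intro y l hl heq
    rw [hwx] at heq
    by_cases hy : y ∈ closedBall x δ
    swap
    · linarith [hfar y hy, sq_nonneg ((f x).toReal - h - l)]
    have hyl := hreal y hy l hl
    have h0 : a * (a * h) + h ≤ (l - (f x).toReal + h) + a * dist w' y := by
      linarith [hmin' y hy]
    have h1 := hCS (dist w' y) (l - (f x).toReal + h) h0
    have h2 : (dist w' y - a * (l - (f x).toReal + h)) ^ 2 / (a ^ 2 + 1) = 0 := by
      apply le_antisymm _ (by positivity)
      linarith
    rw [div_eq_zero_iff, or_iff_left (by positivity), pow_eq_zero_iff two_ne_zero] at h2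
    have hd : dist w' y = a * (l - (f x).toReal + h) := by linarith
    have hu : (l - (f x).toReal + h) = h := by
      rw [hd] at heq h0
      have h3 : (a ^ 2 + 1) * ((l - (f x).toReal + h) ^ 2 - h ^ 2) = 0 := by linarith
      have h4 : (l - (f x).toReal + h) ^ 2 = h ^ 2 := by
        have := (mul_eq_zero.1 h3).resolve_left (by positivity)
        linarith
      have h5 : (a ^ 2 + 1) * h ≤ (a ^ 2 + 1) * (l - (f x).toReal + h) := by linarith
      have h6 := le_of_mul_le_mul_left h5 (by positivity)
      exact (sq_eq_sq₀ (hhpos.le.trans h6) hhpos.le).1 h4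
    rw [hu] at hd
    have hlx : l = (f x).toReal := by linarith
    refine ⟨?_, hlx⟩
    by_contra hyx
    obtain ⟨η, hη0, hη1, hηl, hη⟩ := hX.exists_geodesic (p := x) (y := y) (Ne.symm hyx)
    rw [mem_closedBall'] at hy
    have hRs := hX.Rsmall x
    have hlt := hX.cat.dist_midpoint_lt hX.kpos w' η hη (by linarith)
      (by rw [hη0]; linarith) (by rw [hη0, hη1]; linarith)
    have hm : η.map (η.l / 2) ∈ closedBall x δ := by
      have := η.dist_map le_rfl (show 0 ≤ η.l / 2 by linarith) (by linarith)
      rw [hη0] at this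
      rw [mem_closedBall']; linarith
    have hc := hconv.toReal_le hbot η (by rw [hη0]; exact hx.ne)
      (by rw [hη1]; exact hfin y (mem_closedBall'.2 hy)) (s := 1 / 2) ⟨by norm_num, by norm_num⟩
    rw [show (1 / 2 : ℝ) * η.l = η.l / 2 by ring, hη0, hη1] at hc
    have h7 := hmin' _ hm
    rw [hη0, hwx] at hlt
    have h8 := mul_lt_mul_of_pos_left hlt ha
    linarith

/-- A function that is finite and continuous at `x` oscillates little near `x`. -/
lemma exists_bounded_near {X : Type*} [MetricSpace X] {f : X → EReal} {x : X}
    (hbot : f x ≠ ⊥) (hx : f x < ⊤) (hcont : ContinuousAt f x) :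
    ∃ ρ > 0, ∀ y ∈ ball x ρ, f y ≠ ⊤ ∧ |(f y).toReal - (f x).toReal| ≤ 1 := by
  have h1 : ∀ᶠ y in nhds x, f y < ⊤ := hcont.eventually_lt_const hx
  have h2 : Tendsto (fun y => (f y).toReal) (nhds x) (nhds (f x).toReal) :=
    (EReal.tendsto_toReal hx.ne hbot).comp hcont
  have h3 := h2.eventually (Metric.closedBall_mem_nhds _ one_pos)
  obtain ⟨ρ, hρ, h⟩ := Metric.eventually_nhds_iff_ball.1 (h1.and h3)
  exact ⟨ρ, hρ, fun y hy => ⟨(h y hy).1.ne, by simpa [Real.dist_eq] using (h y hy).2⟩⟩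

/-- Theorem 4.11: if `f : X → (-∞,∞]` is convex and continuous at `x ∈ dom f`, then
`∂f(x) ≠ ∅`. -/
theorem statement12 {X : Type*} [MetricSpace X] {κ : ℝ} {R : X → ℝ} (hX : Standing κ X R)
    (f : X → EReal) (hfbot : ∀ y, f y ≠ ⊥) (hconv : GConvexFn f)
    (x : X) (hx : f x < ⊤) (hcont : ContinuousAt f x) :
    ∃ (γ : Geodesic X) (r : ℝ), InTangent x γ r ∧ IsSubgrad (R x) f x γ r := by
  have hR := hX.Rpos x
  have := hX.locComp
  obtain ⟨ρ, hρ, hbd⟩ := exists_bounded_near (hfbot x) hx hcont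
  obtain ⟨r₀, hr₀, hcpt₀⟩ := exists_isCompact_closedBall x
  obtain ⟨δ, hδ, hδmin⟩ : ∃ δ > 0, δ ≤ min (min (R x / 8) (ρ / 4)) r₀ :=
    ⟨_, lt_min (lt_min (by positivity) (by positivity)) hr₀, le_rfl⟩
  simp only [le_min_iff] at hδmin
  obtain ⟨⟨hδR, hδρ⟩, hδr⟩ := hδmin
  have hcpt : IsCompact (closedBall x δ) :=
    hcpt₀.of_isClosed_subset isClosed_closedBall (closedBall_subset_closedBall hδr)
  have hbd' : ∀ y ∈ closedBall x (2 * δ), f y ≠ ⊤ ∧ |(f y).toReal - (f x).toReal| ≤ 1 :=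
    fun y hy => hbd y (closedBall_subset_ball (by linarith) hy)
  have hfin : ∀ y ∈ closedBall x δ, f y ≠ ⊤ :=
    fun y hy => (hbd' y (closedBall_subset_closedBall (by linarith) hy)).1
  have hlip : ∀ y ∈ closedBall x δ, ∀ z ∈ closedBall x δ,
      (f z).toReal - (f y).toReal ≤ 2 / δ * dist y z := fun y hy z hz =>
    hconv.toReal_sub_le hfbot (hX.ext x) hδ (by linarith) hbd' hy hz
  have hlocal : (∀ y ∈ closedBall x δ, (f x).toReal ≤ (f y).toReal) →
      ∃ (γ : Geodesic X) (r : ℝ), InTangent x γ r ∧ IsSubgrad (R x) f x γ r := fun hmin =>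
    ⟨constGeod x, 0, ⟨rfl, le_rfl, Or.inl rfl⟩,
      isSubgrad_of_local_min hfbot hx hδ (by linarith) fun y hy l hl =>
        (hmin y hy).trans (by
          simpa using EReal.toReal_le_toReal hl (hfbot y) (EReal.coe_ne_top l))⟩
  by_cases hnot : ∃ y ∈ closedBall x δ, (f y).toReal < (f x).toReal
  swap
  · push Not at hnot
    exact hlocal hnot
  obtain ⟨w, a, hw, ha, hmin⟩ := hX.exists_dist_minimizer hfbot hconv hδ (by linarith) hcpt hfin
    (by positivity) hlip hnot
  rcases ha.eq_or_lt with rfl | ha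
  · exact hlocal fun y hy => by simpa using hmin y hy
  · obtain ⟨γ, hγ⟩ := hX.exists_subgrad_of_dist_minimizer hfbot hx hδ (by linarith) hfin hconv ha
      hw hmin
    exact ⟨γ, a, hγ⟩

end CATPaper
end
end

section
/- Suppose additionally that X has diameter smaller than D_κ/2. Let f : X → (−∞,∞] be convex. Given x ∈ dom f and λ ≥ 0, define φ : X → (−∞,∞] by φ(y) = f(y) + λ d(y,x)². Then ∂φ(x) = ∂f(x). -/
/-!
Basic convex analysis in metric spaces with bounded curvature:
common definitions (geodesics, Alexandrov angles, tangent-space elements,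
normal cones, subdifferentials, CAT(κ) conditions).
-/

open Metric Real Set Filter

noncomputable section

namespace CATPaper

open scoped Topology

/-- `sinc` is antitone on `[0, π]`. -/
lemma antitoneOn_sinc : AntitoneOn Real.sinc (Set.Icc 0 π) := by
  intro a ha b hb hab
  rcases ha.1.eq_or_lt with rfl | ha0
  · simpa using Real.sinc_le_one b
  have hb0 : 0 < b := ha0.trans_le hab
  rw [Real.sinc_of_ne_zero ha0.ne', Real.sinc_of_ne_zero hb0.ne', div_le_div_iff₀ hb0 ha0]
  have h := strictConcaveOn_sin_Icc.concaveOn.2 (x := 0) ⟨le_rfl, Real.pi_pos.le⟩ hb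
    (sub_nonneg.2 ((div_le_one hb0).2 hab)) (div_nonneg ha0.le hb0.le) (sub_add_cancel _ _)
  simp only [smul_eq_mul, Real.sin_zero, mul_zero, zero_add, div_mul_cancel₀ _ hb0.ne'] at h
  rw [div_mul_eq_mul_div, div_le_iff₀ hb0] at h
  linarith

/-- The tangent-line inequality for the convex function `w ↦ arccos(w)²`. -/
lemma two_mul_cos_sub_cos_le {a b : ℝ} (ha : a ∈ Set.Icc 0 π) (hb : b ∈ Set.Icc 0 π) :
    2 * (Real.cos b - Real.cos a) ≤ (a ^ 2 - b ^ 2) * Real.sinc b := by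
  let F : ℝ → ℝ := fun z => z ^ 2 * Real.sinc b + 2 * Real.cos z
  have hF : ∀ z, HasDerivAt F (2 * z * Real.sinc b - 2 * Real.sin z) z := fun z => by
    have h := ((hasDerivAt_pow 2 z).mul_const (Real.sinc b)).add
      ((Real.hasDerivAt_cos z).const_mul 2)
    exact h.congr_deriv (by norm_num; ring)
  have hsin : ∀ z, Real.sin z = z * Real.sinc z := fun z => by
    by_cases hz : z = 0
    · simp [hz]
    · rw [Real.sinc_of_ne_zero hz, mul_div_cancel₀ _ hz]
  have hcont : Continuous F := continuous_iff_continuousAt.2 fun z => (hF z).continuousAt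
  have hdiff : Differentiable ℝ F := fun z => (hF z).differentiableAt
  have hmain : F b ≤ F a := by
    rcases le_total a b with hab | hab
    · refine antitoneOn_of_deriv_nonpos (convex_Icc 0 b) hcont.continuousOn
        hdiff.differentiableOn (fun z hz => ?_) ⟨ha.1, hab⟩ ⟨hb.1, le_rfl⟩ hab
      rw [interior_Icc] at hz
      have := antitoneOn_sinc ⟨hz.1.le, hz.2.le.trans hb.2⟩ hb hz.2.le
      rw [(hF z).deriv, hsin z]
      nlinarith [hz.1]
    · refine monotoneOn_of_deriv_nonneg (convex_Icc b π) hcont.continuousOn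
        hdiff.differentiableOn (fun z hz => ?_) ⟨le_rfl, hb.2⟩ ⟨hab, ha.2⟩ hab
      rw [interior_Icc] at hz
      have := antitoneOn_sinc hb ⟨hb.1.trans hz.1.le, hz.2.le⟩ hz.1.le
      rw [(hF z).deriv, hsin z]
      nlinarith [hz.1, hb.1]
  simp only [F] at hmain
  linarith

lemma sinc_pos {a : ℝ} (h0 : 0 ≤ a) (h1 : a < π) : 0 < Real.sinc a := by
  rcases h0.eq_or_lt with rfl | h0
  · simp
  · rw [Real.sinc_of_ne_zero h0.ne']
    exact div_pos (Real.sin_pos_of_pos_of_lt_pi h0 h1) h0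

/-- In a spherical triangle with sides `a, b, c < π / 2`, the first variation of the squared
distance from a vertex along the opposite side is less than the difference of its values at
the endpoints. -/
lemma spherical_first_variation_lt {a b c : ℝ} (ha0 : 0 < a) (ha : a < π / 2)
    (hb0 : 0 ≤ b) (hb : b < π / 2) (hc0 : 0 ≤ c) (hc : c < π / 2) :
    2 / Real.sinc b * (a * (Real.cos a * Real.cos b - Real.cos c) / Real.sin a) <
      c ^ 2 - b ^ 2 := by
  have hs : 0 < Real.sin a := Real.sin_pos_of_pos_of_lt_pi ha0 (by linarith)
  have hca : 0 < Real.cos a := Real.cos_pos_of_mem_Ioo ⟨by linarith, ha⟩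
  have hcb : 0 < Real.cos b := Real.cos_pos_of_mem_Ioo ⟨by linarith, hb⟩
  have hcc : 0 < Real.cos c := Real.cos_pos_of_mem_Ioo ⟨by linarith, hc⟩
  have h1 : Real.sin a < a := Real.sin_lt ha0
  have h2 : a * Real.cos a < Real.sin a := by
    have := Real.lt_tan ha0 ha
    rwa [Real.tan_eq_sin_div_cos, lt_div_iff₀ hca] at this
  have ht := two_mul_cos_sub_cos_le (a := c) (b := b) ⟨hc0, by linarith⟩ ⟨hb0, by linarith⟩
  have hsb := sinc_pos hb0 (by linarith [Real.pi_pos])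
  rw [div_mul_eq_mul_div, div_lt_iff₀ hsb]
  refine lt_of_lt_of_le ?_ ht
  have : a * (Real.cos a * Real.cos b - Real.cos c) / Real.sin a < Real.cos b - Real.cos c := by
    rw [div_lt_iff₀ hs]
    nlinarith [mul_pos hcb (sub_pos.2 h2), mul_pos hcc (sub_pos.2 h1)]
  linarith

/-- The comparison inequality of a `CAT(κ)` space, in terms of cosines. -/
lemma IsCATK.cos_dist_ge {X : Type*} [MetricSpace X] {κ : ℝ} (hκ : 0 < κ) (hcat : IsCATK κ X)
    (hdiam : ∀ p q : X, Real.sqrt κ * dist p q < π / 2) (p : X) (η : Geodesic X)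
    (hl : 0 < η.l) {s : ℝ} (hs : s ∈ Set.Icc 0 η.l) :
    (Real.sin (Real.sqrt κ * η.l - Real.sqrt κ * s) * Real.cos (Real.sqrt κ * dist p (η.map 0)) +
      Real.sin (Real.sqrt κ * s) * Real.cos (Real.sqrt κ * dist p (η.map η.l))) /
        Real.sin (Real.sqrt κ * η.l) ≤ Real.cos (Real.sqrt κ * dist p (η.map s)) := by
  have hk : 0 < Real.sqrt κ := Real.sqrt_pos.2 hκ
  have hηl : dist (η.map 0) (η.map η.l) = η.l := by
    rw [η.isom 0 ⟨le_rfl, hl.le⟩ η.l ⟨hl.le, le_rfl⟩]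
    simp [abs_of_pos hl]
  have hper : dist p (η.map 0) + dist p (η.map η.l) + η.l < 2 * Dk κ := by
    have h1 := hdiam p (η.map 0)
    have h2 := hdiam p (η.map η.l)
    have h3 := hdiam (η.map 0) (η.map η.l)
    rw [hηl] at h3
    rw [Dk, ← mul_div_assoc, lt_div_iff₀ hk]
    nlinarith [Real.pi_pos]
  have hcmp := hcat.2 p η hper s hs
  rw [modelCompDist, one_div, ← div_eq_inv_mul, le_div_iff₀ hk, mul_comm] at hcmp
  have hda := hdiam (η.map 0) (η.map η.l)
  have hdb := hdiam p (η.map 0)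
  have hdc := hdiam p (η.map η.l)
  have hb0 : 0 ≤ Real.sqrt κ * dist p (η.map 0) := by positivity
  have hc0 : 0 ≤ Real.sqrt κ * dist p (η.map η.l) := by positivity
  have htri1 : Real.sqrt κ * η.l ≤
      Real.sqrt κ * dist p (η.map 0) + Real.sqrt κ * dist p (η.map η.l) := by
    have h := dist_triangle_left (η.map 0) (η.map η.l) p
    rw [hηl] at h
    nlinarith
  have htri2 : Real.sqrt κ * dist p (η.map 0) ≤
      Real.sqrt κ * η.l + Real.sqrt κ * dist p (η.map η.l) := by
    have h := dist_triangle_right p (η.map 0) (η.map η.l)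
    rw [hηl] at h
    nlinarith
  have htri3 : Real.sqrt κ * dist p (η.map η.l) ≤
      Real.sqrt κ * η.l + Real.sqrt κ * dist p (η.map 0) := by
    have h := dist_triangle p (η.map 0) (η.map η.l)
    rw [hηl] at h
    nlinarith
  have ha0 : 0 < Real.sqrt κ * η.l := mul_pos hk hl
  have hs0 : 0 ≤ Real.sqrt κ * s := mul_nonneg hk.le hs.1
  have hsl : Real.sqrt κ * s ≤ Real.sqrt κ * η.l := mul_le_mul_of_nonneg_left hs.2 hk.le
  have hD0 : 0 ≤ Real.sqrt κ * dist p (η.map s) := by positivity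
  rw [hηl] at hda
  generalize Real.sqrt κ * dist p (η.map s) = D at *
  generalize Real.sqrt κ * dist p (η.map 0) = b at *
  generalize Real.sqrt κ * dist p (η.map η.l) = c at *
  generalize Real.sqrt κ * η.l = a at *
  generalize Real.sqrt κ * s = z at *
  have hsa : 0 < Real.sin a := Real.sin_pos_of_pos_of_lt_pi ha0 (by linarith)
  have hsz : 0 ≤ Real.sin z := Real.sin_nonneg_of_nonneg_of_le_pi hs0 (by linarith)
  have hcc : Real.cos c ≤ Real.cos (a - b) := by
    rw [← Real.cos_abs (a - b)]
    refine Real.cos_le_cos_of_nonneg_of_le_pi (abs_nonneg _) (by linarith) (abs_le.2 ⟨?_, ?_⟩) <;>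
      linarith
  have hG : Real.cos b * Real.cos z + Real.sin b * Real.sin z *
      ((Real.cos c - Real.cos a * Real.cos b) / (Real.sin a * Real.sin b)) =
      (Real.sin (a - z) * Real.cos b + Real.sin z * Real.cos c) / Real.sin a := by
    rw [Real.sin_sub]
    rcases hb0.eq_or_lt with rfl | hb0
    · obtain rfl : a = c := by linarith
      field_simp
      simp
    · have hsb : 0 < Real.sin b := Real.sin_pos_of_pos_of_lt_pi hb0 (by linarith)
      field_simp
      ring
  rw [hG] at hcmp
  have hle : (Real.sin (a - z) * Real.cos b + Real.sin z * Real.cos c) / Real.sin a ≤ 1 := by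
    rw [div_le_one hsa]
    calc _ ≤ Real.sin (a - z) * Real.cos b + Real.sin z * Real.cos (a - b) := by gcongr
      _ = Real.sin a * Real.cos (z - b) := by
        rw [Real.sin_sub, Real.cos_sub, Real.cos_sub]
        ring
      _ ≤ Real.sin a := mul_le_of_le_one_right hsa.le (Real.cos_le_one _)
  refine le_trans ?_ (Real.cos_le_cos_of_nonneg_of_le_pi hD0 (Real.arccos_le_pi _) hcmp)
  rcases le_total (-1) ((Real.sin (a - z) * Real.cos b + Real.sin z * Real.cos c) / Real.sin a)
    with h | h
  · rw [Real.cos_arccos h hle]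
  · exact h.trans (Real.neg_one_le_cos _)

/-- In a `CAT(κ)` space of diameter smaller than `D_κ / 2`, the squared distance to a point
grows at the start of a nonconstant geodesic at a rate strictly smaller than its mean rate. -/
lemma IsCATK.exists_first_variation {X : Type*} [MetricSpace X] {κ : ℝ} (hκ : 0 < κ)
    (hcat : IsCATK κ X) (hdiam : ∀ p q : X, Real.sqrt κ * dist p q < π / 2) (p : X)
    (η : Geodesic X) (hl : 0 < η.l) :
    ∃ ℓ : ℝ, ℓ * η.l < dist p (η.map η.l) ^ 2 - dist p (η.map 0) ^ 2 ∧
      ∀ᶠ s in 𝓝[>] (0 : ℝ), dist p (η.map s) ^ 2 ≤ dist p (η.map 0) ^ 2 + s * ℓ := by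
  have hk : 0 < Real.sqrt κ := Real.sqrt_pos.2 hκ
  have hηl : dist (η.map 0) (η.map η.l) = η.l := by
    rw [η.isom 0 ⟨le_rfl, hl.le⟩ η.l ⟨hl.le, le_rfl⟩]
    simp [abs_of_pos hl]
  have hda := hdiam (η.map 0) (η.map η.l)
  rw [hηl] at hda
  have hcos := fun s => hcat.cos_dist_ge hκ hdiam p η hl (s := s)
  set k := Real.sqrt κ
  set b := dist p (η.map 0)
  set c := dist p (η.map η.l)
  have hsa : 0 < Real.sin (k * η.l) :=
    Real.sin_pos_of_pos_of_lt_pi (mul_pos hk hl) (by linarith [Real.pi_pos])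
  let G : ℝ → ℝ := fun s =>
    (Real.sin (k * η.l - k * s) * Real.cos (k * b) + Real.sin (k * s) * Real.cos (k * c)) /
      Real.sin (k * η.l)
  have hG0 : G 0 = Real.cos (k * b) := by
    simp [G, hsa.ne']
  let G' := k * (Real.cos (k * c) - Real.cos (k * η.l) * Real.cos (k * b)) / Real.sin (k * η.l)
  have hG : HasDerivAt G G' 0 := by
    have h1 : HasDerivAt (fun s : ℝ => k * s) k 0 := by
      simpa using (hasDerivAt_id (0 : ℝ)).const_mul k
    have h2 := (((h1.const_sub (k * η.l)).sin.mul_const (Real.cos (k * b))).add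
      (h1.sin.mul_const (Real.cos (k * c)))).div_const (Real.sin (k * η.l))
    refine h2.congr_deriv ?_
    simp only [G', mul_zero, sub_zero, Real.cos_zero]
    ring
  have hD : Tendsto (fun s => dist p (η.map s)) (𝓝[>] 0) (𝓝 b) := by
    rw [tendsto_iff_dist_tendsto_zero]
    refine squeeze_zero' (g := fun s => s) (Eventually.of_forall fun _ => dist_nonneg) ?_
      (tendsto_nhdsWithin_of_tendsto_nhds tendsto_id)
    filter_upwards [Ioc_mem_nhdsGT hl] with s hs
    calc dist (dist p (η.map s)) b ≤ dist (η.map s) (η.map 0) := by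
          simpa using dist_dist_dist_le p (η.map s) p (η.map 0)
      _ = s := by
          rw [η.isom s ⟨hs.1.le, hs.2⟩ 0 ⟨le_rfl, hl.le⟩]
          simp [abs_of_pos hs.1]
  have hsb : 0 < Real.sinc (k * b) :=
    sinc_pos (mul_nonneg hk.le dist_nonneg) (by linarith [hdiam p (η.map 0), Real.pi_pos])
  have hlim : Tendsto (fun s => 2 / Real.sinc (k * dist p (η.map s)) *
      -(s⁻¹ * (G s - G 0)) / k ^ 2) (𝓝[>] 0) (𝓝 (2 / Real.sinc (k * b) * -G' / k ^ 2)) := by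
    have h1 : Tendsto (fun s => s⁻¹ * (G s - G 0)) (𝓝[>] 0) (𝓝 G') := by
      simpa using hG.tendsto_slope_zero_right
    have h2 : Tendsto (fun s => Real.sinc (k * dist p (η.map s))) (𝓝[>] 0)
        (𝓝 (Real.sinc (k * b))) :=
      (Real.continuous_sinc.tendsto _).comp (hD.const_mul k)
    exact ((tendsto_const_nhds.div h2 hsb.ne').mul h1.neg).div_const _
  have hlt : 2 / Real.sinc (k * b) * -G' / k ^ 2 < (c ^ 2 - b ^ 2) / η.l := by
    have h := spherical_first_variation_lt (mul_pos hk hl) hda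
      (mul_nonneg hk.le (dist_nonneg (x := p) (y := η.map 0))) (hdiam p (η.map 0))
      (mul_nonneg hk.le (dist_nonneg (x := p) (y := η.map η.l))) (hdiam p (η.map η.l))
    rw [lt_div_iff₀ hl, div_mul_eq_mul_div, div_lt_iff₀ (by positivity)]
    calc _ = _ := ?_
      _ < _ := h
      _ = _ := by ring
    simp only [G', b, c]
    ring
  obtain ⟨ℓ, hℓ1, hℓ2⟩ := exists_between hlt
  refine ⟨ℓ, (lt_div_iff₀ hl).1 hℓ2, ?_⟩
  filter_upwards [hlim.eventually_lt_const hℓ1, Ioc_mem_nhdsGT hl] with s hs hsl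
  have hb := hdiam p (η.map 0)
  have hDs := hdiam p (η.map s)
  have hsD : 0 < Real.sinc (k * dist p (η.map s)) :=
    sinc_pos (mul_nonneg hk.le dist_nonneg) (by linarith [Real.pi_pos])
  have ht := two_mul_cos_sub_cos_le (a := k * b) (b := k * dist p (η.map s))
    ⟨mul_nonneg hk.le dist_nonneg, by linarith [Real.pi_pos]⟩
    ⟨mul_nonneg hk.le dist_nonneg, by linarith [Real.pi_pos]⟩
  have hc := hcos s ⟨hsl.1.le, hsl.2⟩
  change G s ≤ _ at hc
  rw [div_lt_iff₀ (by positivity), div_mul_eq_mul_div, div_lt_iff₀ hsD, hG0] at hs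
  have hs' : 2 * (Real.cos (k * b) - G s) ≤
      s * ℓ * k ^ 2 * Real.sinc (k * dist p (η.map s)) := by
    have := mul_le_mul_of_nonneg_left hs.le hsl.1.le
    have h3 : s * (2 * -(s⁻¹ * (G s - Real.cos (k * b)))) = 2 * (Real.cos (k * b) - G s) := by
      have := hsl.1.ne'
      field_simp
      ring
    rw [h3] at this
    linarith
  have hfin : 0 ≤ (s * ℓ * k ^ 2 + (k * b) ^ 2 - (k * dist p (η.map s)) ^ 2) *
      Real.sinc (k * dist p (η.map s)) := by
    linarith
  have := nonneg_of_mul_nonneg_left hfin hsD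
  have h4 : 0 ≤ k ^ 2 * (s * ℓ + b ^ 2 - dist p (η.map s) ^ 2) := by linarith
  linarith [nonneg_of_mul_nonneg_right h4 (by positivity)]

lemma dist_toXR_sq {X : Type*} [MetricSpace X] (P : XR X) (y : X) (a : ℝ) :
    dist P (toXR y a) ^ 2 = dist P.fst y ^ 2 + (a - P.snd) ^ 2 := by
  rw [WithLp.prod_dist_eq_add (by norm_num)]
  simp only [ENNReal.toReal_ofNat, Real.rpow_ofNat]
  rw [← Real.sqrt_eq_rpow, Real.sq_sqrt (by positivity), Real.dist_eq, sq_abs, ← neg_sub, neg_sq]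
  rfl

lemma toXR_mem_epigraph {X : Type*} [MetricSpace X] {f : X → EReal} {y : X} {a : ℝ} :
    toXR y a ∈ epigraph f ↔ f y ≤ (a : EReal) := Iff.rfl

lemma projSet_eq_singleton_iff {X : Type*} [MetricSpace X] {C : Set X} {z q : X} :
    projSet C z = {q} ↔ q ∈ C ∧ ∀ c ∈ C, c ≠ q → dist z q < dist z c := by
  constructor
  · intro h
    have hq : q ∈ projSet C z := h ▸ Set.mem_singleton q
    refine ⟨hq.1, fun c hc hne => lt_of_not_ge fun hle => hne ?_⟩
    have : c ∈ projSet C z := ⟨hc, fun c' hc' => hle.trans (hq.2 c' hc')⟩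
    rwa [h] at this
  · rintro ⟨hq, hlt⟩
    ext c
    refine ⟨fun hc => ?_, ?_⟩
    · by_contra hne
      exact absurd (hc.2 q hq) (not_le.2 (hlt c hc.1 hne))
    · rintro rfl
      refine ⟨hq, fun c' hc' => ?_⟩
      rcases eq_or_ne c' c with rfl | hne
      · exact le_rfl
      · exact (hlt c' hc' hne).le

/-- If `(x, v)` is the projection of a point on the epigraph of `f + λ d(·, x)²`, then it is
also its projection on the epigraph of the convex function `f`. -/
lemma projSet_epigraph_of_add_sq {X : Type*} [MetricSpace X] {κ : ℝ} (hκ : 0 < κ)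
    (hcat : IsCATK κ X) (hgeod : GeodesicSpace X)
    (hdiam : ∀ p q : X, Real.sqrt κ * dist p q < π / 2)
    {f : X → EReal} (hfbot : ∀ y, f y ≠ ⊥) (hconv : GConvexFn f) {x : X} {v lam : ℝ}
    (hv : f x = v) {P : XR X}
    (h : projSet (epigraph fun y => f y + ((lam * dist y x ^ 2 : ℝ) : EReal)) P = {toXR x v}) :
    projSet (epigraph f) P = {toXR x v} := by
  rw [projSet_eq_singleton_iff] at h ⊢
  refine ⟨toXR_mem_epigraph.2 hv.le, fun q hq hne => ?_⟩
  obtain ⟨y, μ, rfl⟩ : ∃ y μ, q = toXR y μ := ⟨q.fst, q.snd, rfl⟩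
  rw [toXR_mem_epigraph] at hq
  rcases eq_or_ne y x with rfl | hyx
  · exact h.2 _ (toXR_mem_epigraph.2 (by simpa using hq)) hne
  refine lt_of_not_ge fun hle => ?_
  have hle' := pow_le_pow_left₀ dist_nonneg hle 2
  rw [dist_toXR_sq, dist_toXR_sq] at hle'
  obtain ⟨η, hη0, hηl, hη1⟩ := hgeod x y
  have hl : 0 < η.l := hηl ▸ dist_pos.2 hyx.symm
  obtain ⟨ℓ, hℓ, hev⟩ := hcat.exists_first_variation hκ hdiam P.fst η hl
  rw [hη0, hη1] at hℓ
  rw [hη0] at hev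
  set d := η.l with hd
  have hepi : ∀ s ∈ Set.Ioc 0 d, toXR (η.map s) (v + s / d * (μ - v) + lam * s ^ 2) ∈
      epigraph fun y => f y + ((lam * dist y x ^ 2 : ℝ) : EReal) := by
    intro s hs
    rw [toXR_mem_epigraph]
    have hdx : dist (η.map s) x = s := by
      rw [← hη0, η.isom s ⟨hs.1.le, hs.2⟩ 0 ⟨le_rfl, hl.le⟩, sub_zero, abs_of_pos hs.1]
    have hu : s / d ∈ Set.Icc (0 : ℝ) 1 := ⟨div_nonneg hs.1.le hl.le, (div_le_one hl).2 hs.2⟩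
    have hc := hconv η (s / d) hu
    rw [← hd, div_mul_cancel₀ _ hl.ne', hη0, hη1, hv] at hc
    have hyv : f y = ((f y).toReal : EReal) :=
      (EReal.coe_toReal (ne_top_of_le_ne_top (EReal.coe_ne_top μ) hq) (hfbot y)).symm
    rw [hyv] at hc hq
    rw [EReal.coe_le_coe_iff] at hq
    have hc' : f (η.map s) ≤ ((v + s / d * (μ - v) : ℝ) : EReal) := by
      refine hc.trans ?_
      rw [← EReal.coe_mul, ← EReal.coe_mul, ← EReal.coe_add, EReal.coe_le_coe_iff]
      nlinarith [mul_le_mul_of_nonneg_left hq hu.1]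
    rw [hdx, EReal.coe_add]
    exact add_le_add_left hc' _
  have hge : ∀ᶠ s in 𝓝[>] (0 : ℝ), 0 ≤ ℓ + s * ((μ - v) / d + lam * s) ^ 2 +
      2 * ((μ - v) / d + lam * s) * (v - P.snd) := by
    filter_upwards [hev, Ioc_mem_nhdsGT hl] with s hs hsl
    have hmin : dist P (toXR x v) ≤
        dist P (toXR (η.map s) (v + s / d * (μ - v) + lam * s ^ 2)) := by
      by_cases heq : toXR (η.map s) (v + s / d * (μ - v) + lam * s ^ 2) = toXR x v
      · rw [heq]
      · exact (h.2 _ (hepi s hsl) heq).le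
    have hmin' := pow_le_pow_left₀ dist_nonneg hmin 2
    rw [dist_toXR_sq, dist_toXR_sq] at hmin'
    have : 0 ≤ s * (ℓ + s * ((μ - v) / d + lam * s) ^ 2 +
        2 * ((μ - v) / d + lam * s) * (v - P.snd)) := by
      have hring : v + s / d * (μ - v) + lam * s ^ 2 - P.snd =
          s * ((μ - v) / d + lam * s) + (v - P.snd) := by ring
      rw [hring] at hmin'
      linarith
    exact nonneg_of_mul_nonneg_right this hsl.1
  have hlim : Tendsto (fun s : ℝ => ℓ + s * ((μ - v) / d + lam * s) ^ 2 +
      2 * ((μ - v) / d + lam * s) * (v - P.snd)) (𝓝[>] 0)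
      (𝓝 (ℓ + 2 * ((μ - v) / d) * (v - P.snd))) := by
    refine tendsto_nhdsWithin_of_tendsto_nhds ?_
    have hcont : Continuous fun s : ℝ => ℓ + s * ((μ - v) / d + lam * s) ^ 2 +
        2 * ((μ - v) / d + lam * s) * (v - P.snd) := by fun_prop
    simpa using hcont.tendsto 0
  have hnonneg := mul_nonneg (ge_of_tendsto hlim hge) hl.le
  have hring : (ℓ + 2 * ((μ - v) / d) * (v - P.snd)) * d =
      ℓ * d + 2 * (μ - v) * (v - P.snd) := by
    field_simp
  rw [hring] at hnonneg
  nlinarith [sq_nonneg (μ - v)]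

/-- Lemma 4.18: for `f` convex, `x ∈ dom f` and `λ ≥ 0`, the function
`φ(y) = f(y) + λ d(y,x)²` satisfies `∂φ(x) = ∂f(x)`. -/
theorem statement16 {X : Type*} [MetricSpace X] {κ : ℝ} {R : X → ℝ} (hX : Standing κ X R)
    (hdiam : ∃ D : ℝ, D < Dk κ / 2 ∧ ∀ p q : X, dist p q ≤ D)
    (f : X → EReal) (hfbot : ∀ y, f y ≠ ⊥) (hconv : GConvexFn f)
    (x : X) (hx : f x < ⊤) (lam : ℝ) (hlam : 0 ≤ lam)
    (γ : Geodesic X) (r : ℝ) (hT : InTangent x γ r) :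
    IsSubgrad (R x) (fun y => f y + ((lam * dist y x ^ 2 : ℝ) : EReal)) x γ r ↔
      IsSubgrad (R x) f x γ r := by
  obtain ⟨D, hD, hdist⟩ := hdiam
  have hk : 0 < Real.sqrt κ := Real.sqrt_pos.2 hX.kpos
  have hdiam' : ∀ p q : X, Real.sqrt κ * dist p q < π / 2 := fun p q => by
    have h := (hdist p q).trans_lt hD
    rw [Dk, div_div, mul_comm, ← div_div, lt_div_iff₀ hk] at h
    linarith
  obtain ⟨v, hv⟩ : ∃ v : ℝ, f x = v := ⟨_, (EReal.coe_toReal hx.ne (hfbot x)).symm⟩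
  have hφ : f x + ((lam * dist x x ^ 2 : ℝ) : EReal) = f x := by simp
  simp only [IsSubgrad, hφ]
  simp only [hv, EReal.toReal_coe, InNormalCone, one_ne_zero, false_or]
  refine exists_congr fun σ => and_congr_right fun _ => and_congr_right fun _ =>
    exists_congr fun t => and_congr_right fun _ => and_congr_right fun _ => ⟨?_, fun h => ?_⟩
  · exact projSet_epigraph_of_add_sq hX.kpos hX.cat hX.geod hdiam' hfbot hconv hv
  · rw [projSet_eq_singleton_iff] at h ⊢
    refine ⟨toXR_mem_epigraph.2 (by rw [hφ, hv]), fun c hc => h.2 c ?_⟩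
    refine le_trans ?_ (show f c.fst + _ ≤ (c.snd : EReal) from hc)
    exact le_add_of_nonneg_right (EReal.coe_nonneg.2 (by positivity))

end CATPaper
end
end
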